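/- Let (Z, 𝒜, P) be a probability space, M > 0, and let F be a countable nonempty set of measurable functions f : Z → [0, M]. Let φ : ℝ → ℝ be a disutility function that is Lipschitz with constant L. Then for every n ≥ 1 and δ ∈ (0,1], the n-fold product measure P^n of the set of samples (z₁,...,zₙ) ∈ Z^n satisfying sup_{f∈F} | IOCE_φ(f;P) − IOCE_φ(f;P_n) | ≤ L·( 2·E_{P^n}[Rad_n(F(Z^n))] + M·(2 + √(log(2/δ)))/√n ) is at least 1 − δ, where P_n is the empirical measure of (z₁,...,zₙ). -/

import Mathlib

open MeasureTheory Finset Set ENNReal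

/-- A disutility function: nondecreasing, convex, `φ(0) = 0`, and `1 ∈ ∂φ(0)` (i.e. `φ(t) ≥ t`). -/
def IsDisutility (φ : ℝ → ℝ) : Prop :=
  Monotone φ ∧ ConvexOn ℝ Set.univ φ ∧ φ 0 = 0 ∧ ∀ t : ℝ, t ≤ φ t

/-- The optimized certainty equivalent risk `OCE_φ(f;Q) = inf_λ (λ + ∫ φ(f − λ) dQ)`. -/
noncomputable def OCE {Z : Type*} [MeasurableSpace Z] (φ : ℝ → ℝ) (f : Z → ℝ) (Q : Measure Z) : ℝ :=
  ⨅ lam : ℝ, (lam + ∫ z, φ (f z - lam) ∂Q)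

/-- The inverted OCE risk `IOCE_φ(f;Q) = sup_λ (λ − ∫ φ(λ − f) dQ)`. -/
noncomputable def IOCE {Z : Type*} [MeasurableSpace Z] (φ : ℝ → ℝ) (f : Z → ℝ) (Q : Measure Z) : ℝ :=
  ⨆ lam : ℝ, (lam - ∫ z, φ (lam - f z) ∂Q)

/-- The empirical measure `(1/n)·Σᵢ δ_{zᵢ}` of a sample `z : Fin n → Z`. -/
noncomputable def empMeas {Z : Type*} [MeasurableSpace Z] {n : ℕ} (z : Fin n → Z) : Measure Z :=
  (n : ℝ≥0∞)⁻¹ • ∑ i : Fin n, Measure.dirac (z i)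

/-- The Rademacher average of a function class `F` on a sample `z`:
`2^{-n}·Σ_{ε ∈ {−1,1}ⁿ} sup_{f∈F} (1/n)·Σᵢ εᵢ f(zᵢ)`. -/
noncomputable def rad {Z : Type*} {n : ℕ} (F : Set (Z → ℝ)) (z : Fin n → Z) : ℝ :=
  (2 ^ n : ℝ)⁻¹ * ∑ ε : Fin n → Bool,
    ⨆ f : F, (n : ℝ)⁻¹ * ∑ i : Fin n, (if ε i then (1 : ℝ) else -1) * (f : Z → ℝ) (z i)

/-- A sum over sign patterns of length `n + 1` splits according to the first sign. -/
lemma sum_bool_fin_succ {n : ℕ} (g : (Fin (n + 1) → Bool) → ℝ) :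
    ∑ ε, g ε = ∑ ε : Fin n → Bool,
      (g (Fin.cons true ε : Fin (n + 1) → Bool) + g (Fin.cons false ε : Fin (n + 1) → Bool)) := by
  rw [← (Fin.consEquiv fun _ : Fin (n + 1) => Bool).sum_comp, Fintype.sum_prod_type,
    Fintype.sum_bool, ← Finset.sum_add_distrib]
  rfl

lemma bddAbove_range_of_abs_le {T : Type*} {f : T → ℝ} (h : ∃ B, ∀ t, |f t| ≤ B) :
    BddAbove (Set.range f) := by
  obtain ⟨B, hB⟩ := h
  exact ⟨B, by rintro _ ⟨t, rfl⟩; exact (abs_le.1 (hB t)).2⟩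

lemma exists_abs_le_add {T : Type*} {f g : T → ℝ} (hf : ∃ B, ∀ t, |f t| ≤ B)
    (hg : ∃ B, ∀ t, |g t| ≤ B) : ∃ B, ∀ t, |f t + g t| ≤ B := by
  obtain ⟨B, hB⟩ := hf
  obtain ⟨C, hC⟩ := hg
  exact ⟨B + C, fun t => (abs_add_le _ _).trans (add_le_add (hB t) (hC t))⟩

lemma exists_abs_le_const_mul {T : Type*} {f : T → ℝ} (c : ℝ) (hf : ∃ B, ∀ t, |f t| ≤ B) :
    ∃ B, ∀ t, |c * f t| ≤ B := by
  obtain ⟨B, hB⟩ := hf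
  exact ⟨|c| * B, fun t => by rw [abs_mul]; gcongr; exact hB t⟩

lemma exists_abs_le_sum {T ι : Type*} [Fintype ι] {f : ι → T → ℝ}
    (hf : ∀ i, ∃ B, ∀ t, |f i t| ≤ B) : ∃ B, ∀ t, |∑ i, f i t| ≤ B := by
  choose B hB using hf
  exact ⟨∑ i, B i, fun t =>
    (Finset.abs_sum_le_sum_abs _ _).trans (Finset.sum_le_sum fun i _ => hB i t)⟩

lemma exists_abs_le_comp_of_lipschitz {T : Type*} {ψ : ℝ → ℝ} {L : ℝ}
    (hψ : ∀ x y, |ψ x - ψ y| ≤ L * |x - y|) {u : T → ℝ} (hu : ∃ B, ∀ t, |u t| ≤ B) :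
    ∃ B, ∀ t, |ψ (u t)| ≤ B := by
  have hL : 0 ≤ L := by simpa using (abs_nonneg _).trans (hψ 1 0)
  obtain ⟨B, hB⟩ := hu
  refine ⟨L * B + |ψ 0|, fun t => ?_⟩
  have h1 := hψ (u t) 0
  rw [sub_zero] at h1
  have h2 := mul_le_mul_of_nonneg_left (hB t) hL
  have h3 := abs_sub_abs_le_abs_sub (ψ (u t)) (ψ 0)
  linarith

/-- The two-point comparison behind the contraction principle. -/
lemma iSup_add_iSup_sub_le {T : Type*} [Nonempty T] {ψ : ℝ → ℝ} {L : ℝ}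
    (hψ : ∀ x y, |ψ x - ψ y| ≤ L * |x - y|) {a u : T → ℝ}
    (ha : ∃ B, ∀ t, |a t| ≤ B) (hu : ∃ B, ∀ t, |u t| ≤ B) :
    (⨆ t, (a t + ψ (u t))) + ⨆ t, (a t - ψ (u t)) ≤
      (⨆ t, (a t + L * u t)) + ⨆ t, (a t - L * u t) := by
  have b1 : BddAbove (Set.range fun t => a t + L * u t) :=
    bddAbove_range_of_abs_le (exists_abs_le_add ha (exists_abs_le_const_mul L hu))
  have b2 : BddAbove (Set.range fun t => a t - L * u t) := by
    have := bddAbove_range_of_abs_le (exists_abs_le_add ha (exists_abs_le_const_mul (-L) hu))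
    simpa only [neg_mul, ← sub_eq_add_neg] using this
  have key : ∀ t t', (a t + ψ (u t)) + (a t' - ψ (u t')) ≤
      (⨆ t, (a t + L * u t)) + ⨆ t, (a t - L * u t) := by
    intro t t'
    have h := (le_abs_self _).trans (hψ (u t) (u t'))
    have h1 := le_ciSup b1 t
    have h2 := le_ciSup b2 t
    have h1' := le_ciSup b1 t'
    have h2' := le_ciSup b2 t'
    beta_reduce at h1 h2 h1' h2'
    rcases abs_cases (u t - u t') with ⟨e, _⟩ | ⟨e, _⟩ <;> rw [e] at h <;> linarith
  rw [← le_sub_iff_add_le]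
  refine ciSup_le fun t => ?_
  rw [le_sub_comm]
  refine ciSup_le fun t' => ?_
  linarith [key t t']

/-- The Ledoux–Talagrand contraction principle for Rademacher sums. -/
lemma sum_iSup_comp_le {T : Type*} [Nonempty T] {ψ : ℝ → ℝ} {L : ℝ}
    (hψ : ∀ x y, |ψ x - ψ y| ≤ L * |x - y|) (n : ℕ) (u : Fin n → T → ℝ) (a : T → ℝ)
    (ha : ∃ B, ∀ t, |a t| ≤ B) (hu : ∀ i, ∃ B, ∀ t, |u i t| ≤ B) :
    ∑ ε : Fin n → Bool, ⨆ t, (a t + ∑ i, (if ε i then (1 : ℝ) else -1) * ψ (u i t)) ≤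
      ∑ ε : Fin n → Bool, ⨆ t, (a t + ∑ i, (if ε i then (1 : ℝ) else -1) * (L * u i t)) := by
  induction n generalizing a with
  | zero => simp
  | succ n ih =>
    have hψ0 := exists_abs_le_comp_of_lipschitz hψ (hu 0)
    have h1 := ih (fun i => u i.succ) (fun t => a t + ψ (u 0 t))
      (exists_abs_le_add ha hψ0) (fun i => hu i.succ)
    have h2 := ih (fun i => u i.succ) (fun t => a t + (-1) * ψ (u 0 t))
      (exists_abs_le_add ha (exists_abs_le_const_mul _ hψ0)) (fun i => hu i.succ)
    rw [sum_bool_fin_succ, sum_bool_fin_succ]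
    simp only [Fin.sum_univ_succ, Fin.cons_zero, Fin.cons_succ, if_true, Bool.false_eq_true,
      if_false, Finset.sum_add_distrib, ← add_assoc] at h1 h2 ⊢
    refine (add_le_add (by simpa only [one_mul] using h1) h2).trans ?_
    rw [← Finset.sum_add_distrib, ← Finset.sum_add_distrib]
    refine Finset.sum_le_sum fun ε _ => ?_
    have h3 := iSup_add_iSup_sub_le hψ (u := u 0)
      (a := fun t => a t + ∑ i : Fin n, (if ε i then (1 : ℝ) else -1) * (L * u i.succ t))
      (exists_abs_le_add ha (exists_abs_le_sum fun i =>
        exists_abs_le_const_mul _ (exists_abs_le_const_mul _ (hu i.succ)))) (hu 0)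
    convert h3 using 2 <;> congr 1 <;> funext t <;> ring

lemma sum_sq_signs (n : ℕ) :
    ∑ ε : Fin n → Bool, (∑ i, (if ε i then (1 : ℝ) else -1)) ^ 2 = 2 ^ n * n := by
  induction n with
  | zero => simp
  | succ n ih =>
    rw [sum_bool_fin_succ]
    simp only [Fin.sum_univ_succ, Fin.cons_zero, Fin.cons_succ, if_true, Bool.false_eq_true,
      if_false]
    have : ∀ s : ℝ, (1 + s) ^ 2 + (-1 + s) ^ 2 = 2 + 2 * s ^ 2 := fun s => by ring
    simp only [this, Finset.sum_add_distrib, ← Finset.mul_sum, ih]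
    simp
    ring

/-- The expected absolute value of a Rademacher sum of length `n` is at most `√n`. -/
lemma sum_abs_signs_le (n : ℕ) :
    ∑ ε : Fin n → Bool, |∑ i, (if ε i then (1 : ℝ) else -1)| ≤ 2 ^ n * √n := by
  refine le_of_sq_le_sq ?_ (by positivity)
  have := sq_sum_le_card_mul_sum_sq (s := (Finset.univ : Finset (Fin n → Bool)))
    (f := fun ε => |∑ i, (if ε i then (1 : ℝ) else -1)|)
  simp only [sq_abs, sum_sq_signs] at this
  refine this.trans (le_of_eq ?_)
  rw [mul_pow, Real.sq_sqrt (by positivity)]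
  simp
  ring

/-- Hoeffding's lemma for a bounded function of oscillation at most `c`. -/
lemma integral_exp_le_of_oscillation {Z : Type*} [MeasurableSpace Z] (P : Measure Z)
    [IsProbabilityMeasure P] {g : Z → ℝ} (hg : Measurable g) {B c : ℝ} (hB : ∀ x, |g x| ≤ B)
    (hc : ∀ x y, |g x - g y| ≤ c) (s : ℝ) :
    ∫ x, Real.exp (s * g x) ∂P ≤ Real.exp (s * ∫ x, g x ∂P + s ^ 2 * c ^ 2 / 8) := by
  have hne : Nonempty Z := nonempty_of_isProbabilityMeasure P
  have hbb : BddBelow (Set.range g) := ⟨-B, by rintro _ ⟨x, rfl⟩; exact (abs_le.1 (hB x)).1⟩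
  have hI : ∀ x, g x ∈ Set.Icc (⨅ y, g y) ((⨅ y, g y) + c) := fun x =>
    ⟨ciInf_le hbb x, by
      rw [← sub_le_iff_le_add]
      exact le_ciInf fun y => by linarith [(le_abs_self _).trans (hc x y)]⟩
  have h := (ProbabilityTheory.hasSubgaussianMGF_of_mem_Icc (μ := P) hg.aemeasurable
    (Filter.Eventually.of_forall hI)).mgf_le s
  rw [ProbabilityTheory.mgf] at h
  have e : ∀ x, Real.exp (s * g x) =
      Real.exp (s * ∫ x, g x ∂P) * Real.exp (s * (g x - ∫ x, g x ∂P)) := fun x => by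
    rw [← Real.exp_add]; ring_nf
  simp_rw [e]
  rw [integral_const_mul, Real.exp_add]
  refine mul_le_mul_of_nonneg_left (h.trans (le_of_eq ?_)) (Real.exp_pos _).le
  congr 1
  simp only [add_sub_cancel_left, NNReal.coe_pow, NNReal.coe_div, coe_nnnorm, Real.norm_eq_abs,
    NNReal.coe_ofNat, div_pow, sq_abs]
  ring

lemma integrable_of_measurable_of_abs_le {Ω : Type*} [MeasurableSpace Ω] {μ : Measure Ω}
    [IsFiniteMeasure μ] {g : Ω → ℝ} (hg : Measurable g) {B : ℝ} (hB : ∀ x, |g x| ≤ B) :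
    Integrable g μ :=
  Integrable.of_bound hg.aestronglyMeasurable B (Filter.Eventually.of_forall hB)

lemma abs_integral_le_of_abs_le {Ω : Type*} [MeasurableSpace Ω] {μ : Measure Ω}
    [IsProbabilityMeasure μ] {g : Ω → ℝ} {B : ℝ} (hB : ∀ x, |g x| ≤ B) :
    |∫ x, g x ∂μ| ≤ B := by
  have := norm_integral_le_of_norm_le_const (μ := μ) (f := g) (Filter.Eventually.of_forall hB)
  simpa using this

lemma measurable_exp_mul {Ω : Type*} [MeasurableSpace Ω] {g : Ω → ℝ} (hg : Measurable g) (s : ℝ) :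
    Measurable fun x => Real.exp (s * g x) := by fun_prop

lemma abs_exp_mul_le {Ω : Type*} {g : Ω → ℝ} {B : ℝ} (hB : ∀ x, |g x| ≤ B) (s : ℝ) (x : Ω) :
    |Real.exp (s * g x)| ≤ Real.exp (|s| * B) := by
  rw [abs_of_pos (Real.exp_pos _), Real.exp_le_exp]
  refine (le_abs_self _).trans ?_
  rw [abs_mul]
  gcongr
  exact hB x

/-- The exponential moment form of McDiarmid's bounded difference inequality. -/
lemma integral_exp_le_of_bounded_differences {Z : Type*} [MeasurableSpace Z] (P : Measure Z)
    [IsProbabilityMeasure P] {n : ℕ} {Φ : (Fin n → Z) → ℝ} (hΦ : Measurable Φ) {B c : ℝ}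
    (hB : ∀ z, |Φ z| ≤ B)
    (hc : ∀ z z' i, (∀ j, j ≠ i → z j = z' j) → |Φ z - Φ z'| ≤ c) (s : ℝ) :
    ∫ z, Real.exp (s * Φ z) ∂(Measure.pi fun _ : Fin n => P) ≤
      Real.exp (s * ∫ z, Φ z ∂(Measure.pi fun _ : Fin n => P) + s ^ 2 * (n * c ^ 2) / 8) := by
  induction n with
  | zero =>
    have h : ∀ z, Φ z = Φ Fin.elim0 := fun z => congrArg Φ (Subsingleton.elim _ _)
    simp [h]
  | succ n ih =>
    set e := MeasurableEquiv.piFinSuccAbove (fun _ : Fin (n + 1) => Z) 0 with he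
    have hmp := (measurePreserving_piFinSuccAbove (fun _ : Fin (n + 1) => P) 0).symm
    rw [← he] at hmp
    have hes : ∀ x y, e.symm (x, y) = (Fin.cons x y : Fin (n + 1) → Z) := fun x y => by
      rw [MeasurableEquiv.symm_apply_eq]
      exact Prod.ext rfl rfl
    set Ψ : Z × (Fin n → Z) → ℝ := fun p => Φ (e.symm p) with hΨ_def
    have hΨ : Measurable Ψ := hΦ.comp e.symm.measurable
    have hΨB : ∀ p, |Ψ p| ≤ B := fun p => hB _
    rw [← hmp.integral_comp', ← hmp.integral_comp' (g := Φ)]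
    change ∫ p, Real.exp (s * Ψ p) ∂(P.prod (Measure.pi fun _ : Fin n => P)) ≤
      Real.exp (s * ∫ p, Ψ p ∂(P.prod (Measure.pi fun _ : Fin n => P)) + _)
    have hsec : ∀ y, Measurable fun x => Ψ (x, y) := fun y =>
      hΨ.comp (measurable_id.prodMk measurable_const)
    have hint : ∀ y, Integrable (fun x => Ψ (x, y)) P := fun y =>
      integrable_of_measurable_of_abs_le (hsec y) fun x => hΨB _
    have hgm : Measurable fun y => ∫ x, Ψ (x, y) ∂P :=
      (StronglyMeasurable.integral_prod_left hΨ.stronglyMeasurable).measurable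
    have hgB : ∀ y, |∫ x, Ψ (x, y) ∂P| ≤ B := fun y => abs_integral_le_of_abs_le fun x => hΨB _
    have hstep := ih hgm hgB (fun y y' i hy => by
      rw [← integral_sub (hint y) (hint y')]
      refine abs_integral_le_of_abs_le fun x => ?_
      refine hc _ _ i.succ fun j hj => ?_
      rw [hes, hes]
      refine Fin.cases (fun _ => rfl) (fun j hj => ?_) j hj
      simpa using hy j (fun h => hj (h ▸ rfl)))
    rw [integral_prod_symm _ (integrable_of_measurable_of_abs_le (measurable_exp_mul hΨ s)
        (abs_exp_mul_le hΨB s)),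
      integral_prod_symm _ (integrable_of_measurable_of_abs_le hΨ hΨB)]
    have hpt : ∀ y, ∫ x, Real.exp (s * Ψ (x, y)) ∂P ≤
        Real.exp (s ^ 2 * c ^ 2 / 8) * Real.exp (s * ∫ x, Ψ (x, y) ∂P) := fun y => by
      rw [← Real.exp_add, add_comm]
      refine integral_exp_le_of_oscillation P (hsec y) (fun x => hΨB _) (fun x x' => ?_) s
      refine hc _ _ 0 fun j hj => ?_
      rw [hes, hes]
      obtain ⟨k, rfl⟩ := Fin.exists_succ_eq.2 hj
      simp
    calc ∫ y, ∫ x, Real.exp (s * Ψ (x, y)) ∂P ∂(Measure.pi fun _ : Fin n => P)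
        ≤ ∫ y, Real.exp (s ^ 2 * c ^ 2 / 8) * Real.exp (s * ∫ x, Ψ (x, y) ∂P)
            ∂(Measure.pi fun _ : Fin n => P) := by
          refine integral_mono ?_ ?_ hpt
          · exact integrable_of_measurable_of_abs_le
              (StronglyMeasurable.integral_prod_left
                (measurable_exp_mul hΨ s).stronglyMeasurable).measurable
              (fun y => abs_integral_le_of_abs_le fun x => abs_exp_mul_le hΨB s _)
          · exact (integrable_of_measurable_of_abs_le (measurable_exp_mul hgm s)
              (abs_exp_mul_le hgB s)).const_mul _
      _ ≤ _ := by
          rw [integral_const_mul]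
          refine (mul_le_mul_of_nonneg_left hstep (Real.exp_pos _).le).trans (le_of_eq ?_)
          rw [← Real.exp_add]
          congr 1
          push_cast
          ring

/-- McDiarmid's bounded difference inequality. -/
lemma measureReal_ge_le_of_bounded_differences {Z : Type*} [MeasurableSpace Z] (P : Measure Z)
    [IsProbabilityMeasure P] {n : ℕ} {Φ : (Fin n → Z) → ℝ} (hΦ : Measurable Φ) {B c : ℝ}
    (hB : ∀ z, |Φ z| ≤ B)
    (hc : ∀ z z' i, (∀ j, j ≠ i → z j = z' j) → |Φ z - Φ z'| ≤ c) {r : ℝ} (hr : 0 ≤ r) :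
    (Measure.pi fun _ : Fin n => P).real
        {z | r ≤ Φ z - ∫ w, Φ w ∂(Measure.pi fun _ : Fin n => P)} ≤
      Real.exp (-(2 * r ^ 2) / (n * c ^ 2)) := by
  set μ := Measure.pi fun _ : Fin n => P
  have hsub : ProbabilityTheory.HasSubgaussianMGF (fun z => Φ z - ∫ w, Φ w ∂μ)
      (Real.toNNReal (n * c ^ 2 / 4)) μ := by
    have e : ∀ s z, Real.exp (s * (Φ z - ∫ w, Φ w ∂μ)) =
        Real.exp (-(s * ∫ w, Φ w ∂μ)) * Real.exp (s * Φ z) := fun s z => by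
      rw [← Real.exp_add]; ring_nf
    refine ⟨fun s => ?_, fun s => ?_⟩
    · simp_rw [e]
      exact (integrable_of_measurable_of_abs_le (measurable_exp_mul hΦ s)
        (abs_exp_mul_le hB s)).const_mul _
    · rw [ProbabilityTheory.mgf]
      simp_rw [e]
      rw [integral_const_mul, Real.coe_toNNReal _ (by positivity)]
      refine (mul_le_mul_of_nonneg_left (integral_exp_le_of_bounded_differences P hΦ hB hc s)
        (Real.exp_pos _).le).trans (le_of_eq ?_)
      rw [← Real.exp_add]
      congr 1
      ring
  refine (hsub.measure_ge_le hr).trans (le_of_eq ?_)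
  rw [Real.coe_toNNReal _ (by positivity)]
  congr 1
  rcases eq_or_ne ((n : ℝ) * c ^ 2) 0 with h | h
  · simp [h]
  · field_simp
    norm_num

lemma abs_iSup_le_of_abs_le {T : Type*} [Nonempty T] {f : T → ℝ} {B : ℝ} (h : ∀ t, |f t| ≤ B) :
    |⨆ t, f t| ≤ B := by
  obtain ⟨t⟩ := ‹Nonempty T›
  exact abs_le.2 ⟨(abs_le.1 (h t)).1.trans (le_ciSup (bddAbove_range_of_abs_le ⟨B, h⟩) t),
    ciSup_le fun t => (abs_le.1 (h t)).2⟩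

lemma abs_iSup_sub_iSup_le {T : Type*} [Nonempty T] {f g : T → ℝ} {c : ℝ}
    (hf : ∃ B, ∀ t, |f t| ≤ B) (hg : ∃ B, ∀ t, |g t| ≤ B) (h : ∀ t, |f t - g t| ≤ c) :
    |(⨆ t, f t) - ⨆ t, g t| ≤ c := by
  have hf' := bddAbove_range_of_abs_le hf
  have hg' := bddAbove_range_of_abs_le hg
  rw [abs_sub_le_iff, sub_le_iff_le_add, sub_le_iff_le_add]
  constructor <;> refine ciSup_le fun t => ?_
  · linarith [(abs_le.1 (h t)).2, le_ciSup hg' t]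
  · linarith [(abs_le.1 (h t)).1, le_ciSup hf' t]

lemma abs_sum_signs_mul_le {n : ℕ} (ε : Fin n → Bool) {x : Fin n → ℝ} {B : ℝ}
    (hx : ∀ i, |x i| ≤ B) : |∑ i, (if ε i then (1 : ℝ) else -1) * x i| ≤ n * B := by
  refine (Finset.abs_sum_le_sum_abs _ _).trans ?_
  refine (Finset.sum_le_sum fun i _ => (?_ : _ ≤ B)).trans (by simp)
  rw [abs_mul]
  split_ifs <;> simpa using hx i

/-- The largest one-sided deviation of the sums `∑ i, h t (z i)` from their means. -/
noncomputable def supDeviation {Z T : Type*} [MeasurableSpace Z] (P : Measure Z) (h : T → Z → ℝ)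
    {n : ℕ} (z : Fin n → Z) : ℝ :=
  ⨆ t, ∑ i, ((∫ x, h t x ∂P) - h t (z i))

section Symmetrization

variable {Z T : Type*} [MeasurableSpace Z] (P : Measure Z)
  {h : T → Z → ℝ} {B : ℝ}

lemma abs_sum_integral_sub_le [IsProbabilityMeasure P]
    (hB : ∀ t x, |h t x| ≤ B) {n : ℕ} (z : Fin n → Z) (t : T) :
    |∑ i, ((∫ x, h t x ∂P) - h t (z i))| ≤ n * (B + B) := by
  refine (Finset.abs_sum_le_sum_abs _ _).trans ?_
  refine (Finset.sum_le_sum fun i _ => (?_ : _ ≤ B + B)).trans (by simp [mul_add])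
  exact (abs_sub _ _).trans (add_le_add (abs_integral_le_of_abs_le (hB t)) (hB t _))

lemma abs_supDeviation_le [Nonempty T] [IsProbabilityMeasure P]
    (hB : ∀ t x, |h t x| ≤ B) {n : ℕ} (z : Fin n → Z) :
    |supDeviation P h z| ≤ n * (B + B) :=
  abs_iSup_le_of_abs_le fun t => abs_sum_integral_sub_le P hB z t

lemma measurable_supDeviation [Countable T] (hm : ∀ t, Measurable (h t)) {n : ℕ} :
    Measurable fun z : Fin n → Z => supDeviation P h z :=
  Measurable.iSup fun t => Finset.measurable_sum _ fun i _ =>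
    measurable_const.sub ((hm t).comp (measurable_pi_apply i))

lemma supDeviation_bounded_differences [Nonempty T] [IsProbabilityMeasure P]
    (hB : ∀ t x, |h t x| ≤ B) {c : ℝ}
    (hc : ∀ t x y, |h t x - h t y| ≤ c) {n : ℕ} (z z' : Fin n → Z) (i : Fin n)
    (hz : ∀ j, j ≠ i → z j = z' j) : |supDeviation P h z - supDeviation P h z'| ≤ c := by
  refine abs_iSup_sub_iSup_le ⟨_, abs_sum_integral_sub_le P hB z⟩
    ⟨_, abs_sum_integral_sub_le P hB z'⟩ fun t => ?_
  rw [← Finset.sum_sub_distrib, Finset.sum_eq_single i]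
  · refine le_of_eq_of_le ?_ (hc t (z' i) (z i))
    congr 1
    ring
  · intro j _ hj
    rw [hz j hj, sub_self]
  · simp

lemma integral_iSup_signs_eq [IsProbabilityMeasure P]
    (h : T → Z → ℝ) [Countable T] (hm : ∀ t, Measurable (h t)) {n : ℕ}
    (ε : Fin n → Bool) :
    ∫ p : (Fin n → Z) × (Fin n → Z),
        ⨆ t, ∑ i, (if ε i then (1 : ℝ) else -1) * (h t (p.2 i) - h t (p.1 i))
        ∂((Measure.pi fun _ : Fin n => P).prod (Measure.pi fun _ : Fin n => P)) =
      ∫ p : (Fin n → Z) × (Fin n → Z), ⨆ t, ∑ i, (h t (p.2 i) - h t (p.1 i))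
        ∂((Measure.pi fun _ : Fin n => P).prod (Measure.pi fun _ : Fin n => P)) := by
  have he := measurePreserving_arrowProdEquivProdArrow Z Z (Fin n) (fun _ => P) (fun _ => P)
  rw [← he.integral_comp', ← he.integral_comp']
  have hW : MeasurePreserving
      (fun (w : Fin n → Z × Z) i => (if ε i then id else Prod.swap) (w i))
      (Measure.pi fun _ : Fin n => P.prod P) (Measure.pi fun _ : Fin n => P.prod P) := by
    refine measurePreserving_pi _ _ (f := fun i => if ε i then id else Prod.swap) fun i => ?_
    split_ifs
    · exact MeasurePreserving.id _
    · exact Measure.measurePreserving_swap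
  conv_rhs => rw [← hW.map_eq]
  rw [integral_map hW.aemeasurable]
  · refine integral_congr_ae (Filter.Eventually.of_forall fun w => ?_)
    refine iSup_congr fun t => Finset.sum_congr rfl fun i _ => ?_
    cases hε : ε i <;> simp [MeasurableEquiv.arrowProdEquivProdArrow,
      Equiv.arrowProdEquivProdArrow, hε]
  · refine Measurable.aestronglyMeasurable (Measurable.iSup fun t =>
      Finset.measurable_sum _ fun i _ => ?_)
    have h1 : Measurable fun w : Fin n → Z × Z => (w i).1 :=
      measurable_fst.comp (measurable_pi_apply i)
    have h2 : Measurable fun w : Fin n → Z × Z => (w i).2 :=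
      measurable_snd.comp (measurable_pi_apply i)
    exact ((hm t).comp h2).sub ((hm t).comp h1)

lemma measurable_iSup_signs [Countable T] (hm : ∀ t, Measurable (h t)) {n : ℕ}
    (ε : Fin n → Bool) :
    Measurable fun z : Fin n → Z => ⨆ t, ∑ i, (if ε i then (1 : ℝ) else -1) * h t (z i) :=
  Measurable.iSup fun t => Finset.measurable_sum _ fun i _ =>
    ((hm t).comp (measurable_pi_apply i)).const_mul _

lemma integrable_iSup_signs [Nonempty T] [IsProbabilityMeasure P] [Countable T]
    (hm : ∀ t, Measurable (h t)) (hB : ∀ t x, |h t x| ≤ B)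
    {n : ℕ} (ε : Fin n → Bool) :
    Integrable (fun z : Fin n → Z => ⨆ t, ∑ i, (if ε i then (1 : ℝ) else -1) * h t (z i))
      (Measure.pi fun _ : Fin n => P) :=
  integrable_of_measurable_of_abs_le (measurable_iSup_signs hm ε) fun _ =>
    abs_iSup_le_of_abs_le fun t => abs_sum_signs_mul_le ε fun _ => hB t _

lemma integral_supDeviation_le_integral_iSup [Nonempty T] [IsProbabilityMeasure P] [Countable T]
    (hm : ∀ t, Measurable (h t))
    (hB : ∀ t x, |h t x| ≤ B) {n : ℕ} :
    ∫ z, supDeviation P h z ∂(Measure.pi fun _ : Fin n => P) ≤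
      ∫ p : (Fin n → Z) × (Fin n → Z), ⨆ t, ∑ i, (h t (p.2 i) - h t (p.1 i))
        ∂((Measure.pi fun _ : Fin n => P).prod (Measure.pi fun _ : Fin n => P)) := by
  set μ := Measure.pi fun _ : Fin n => P with hμ
  have hb : ∀ (p : (Fin n → Z) × (Fin n → Z)) t,
      |∑ i, (h t (p.2 i) - h t (p.1 i))| ≤ n * (B + B) := fun p t => by
    refine (Finset.abs_sum_le_sum_abs _ _).trans ?_
    refine (Finset.sum_le_sum fun i _ => (?_ : _ ≤ B + B)).trans (by simp [mul_add])
    exact (abs_sub _ _).trans (add_le_add (hB t _) (hB t _))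
  have hKm : Measurable fun p : (Fin n → Z) × (Fin n → Z) =>
      ⨆ t, ∑ i, (h t (p.2 i) - h t (p.1 i)) := by
    refine Measurable.iSup fun t => Finset.measurable_sum _ fun i _ => ?_
    exact ((hm t).comp ((measurable_pi_apply i).comp measurable_snd)).sub
      ((hm t).comp ((measurable_pi_apply i).comp measurable_fst))
  have hKi : Integrable (fun p : (Fin n → Z) × (Fin n → Z) =>
      ⨆ t, ∑ i, (h t (p.2 i) - h t (p.1 i))) (μ.prod μ) :=
    integrable_of_measurable_of_abs_le hKm fun p => abs_iSup_le_of_abs_le (hb p)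
  rw [integral_prod _ hKi]
  refine integral_mono (integrable_of_measurable_of_abs_le (measurable_supDeviation P hm)
    (abs_supDeviation_le P hB)) hKi.integral_prod_left fun z => ?_
  refine ciSup_le fun t => ?_
  have hint : ∀ i : Fin n, Integrable (fun z' : Fin n → Z => h t (z' i)) μ := fun i =>
    integrable_of_measurable_of_abs_le ((hm t).comp (measurable_pi_apply i)) fun _ => hB t _
  have heq : ∑ i, ((∫ x, h t x ∂P) - h t (z i)) =
      ∫ z', ∑ i, (h t (z' i) - h t (z i)) ∂μ := by
    have hint' : ∀ i ∈ Finset.univ,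
        Integrable (fun z' : Fin n → Z => h t (z' i) - h t (z i)) μ := fun i _ =>
      (hint i).sub (integrable_const _)
    rw [integral_finsetSum _ hint']
    refine Finset.sum_congr rfl fun i _ => ?_
    rw [integral_sub (hint i) (integrable_const _), integral_const, probReal_univ, one_smul]
    congr 1
    rw [hμ, integral_comp_eval (hm t).aestronglyMeasurable]
  rw [heq]
  refine integral_mono (integrable_finsetSum _ fun i _ => (hint i).sub (integrable_const _))
    (integrable_of_measurable_of_abs_le (hKm.comp measurable_prodMk_left) fun z' =>
      abs_iSup_le_of_abs_le (hb (z, z'))) fun z' => ?_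
  exact le_ciSup (bddAbove_range_of_abs_le ⟨_, hb (z, z')⟩) t

/-- Symmetrization: the expected supremum deviation is at most twice the expected Rademacher sum. -/
lemma integral_supDeviation_le [Nonempty T] [IsProbabilityMeasure P] [Countable T]
    (hm : ∀ t, Measurable (h t))
    (hB : ∀ t x, |h t x| ≤ B) {n : ℕ} :
    2 ^ n * ∫ z, supDeviation P h z ∂(Measure.pi fun _ : Fin n => P) ≤
      2 * ∫ z, ∑ ε : Fin n → Bool, ⨆ t, ∑ i, (if ε i then (1 : ℝ) else -1) * h t (z i)
        ∂(Measure.pi fun _ : Fin n => P) := by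
  set μ := Measure.pi fun _ : Fin n => P with hμ
  set R : (Fin n → Bool) → (Fin n → Z) → ℝ := fun ε z =>
    ⨆ t, ∑ i, (if ε i then (1 : ℝ) else -1) * h t (z i) with hR
  have hRi : ∀ ε, Integrable (R ε) μ := fun ε => integrable_iSup_signs P hm hB ε
  have hRb : ∀ (ε : Fin n → Bool) (z : Fin n → Z),
      BddAbove (Set.range fun t => ∑ i, (if ε i then (1 : ℝ) else -1) * h t (z i)) :=
    fun ε z => bddAbove_range_of_abs_le ⟨_, fun t => abs_sum_signs_mul_le ε fun i => hB t (z i)⟩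
  have hflip : ∑ ε : Fin n → Bool, ∫ z, R (fun i => !ε i) z ∂μ = ∑ ε, ∫ z, R ε z ∂μ :=
    (Equiv.arrowCongr (Equiv.refl (Fin n)) Equiv.boolNot).sum_comp fun ε => ∫ z, R ε z ∂μ
  have hε : ∀ ε : Fin n → Bool, ∫ z, supDeviation P h z ∂μ ≤
      ∫ z, R ε z ∂μ + ∫ z, R (fun i => !ε i) z ∂μ := fun ε => by
    refine (integral_supDeviation_le_integral_iSup P hm hB).trans ?_
    rw [← integral_iSup_signs_eq P h hm ε]
    have e1 : ∫ z, R ε z ∂μ = ∫ p, R ε p.2 ∂(μ.prod μ) := by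
      rw [integral_fun_snd]; simp
    have e2 : ∫ z, R (fun i => !ε i) z ∂μ = ∫ p, R (fun i => !ε i) p.1 ∂(μ.prod μ) := by
      rw [integral_fun_fst]; simp
    rw [e1, e2, ← integral_add ((hRi _).comp_snd _) ((hRi _).comp_fst _)]
    refine integral_mono ?_ (((hRi _).comp_snd _).add ((hRi _).comp_fst _)) fun p => ?_
    · refine integrable_of_measurable_of_abs_le (B := n * (B + B)) ?_ fun p =>
        abs_iSup_le_of_abs_le fun t => abs_sum_signs_mul_le ε fun i =>
          (abs_sub _ _).trans (add_le_add (hB t _) (hB t _))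
      refine Measurable.iSup fun t => Finset.measurable_sum _ fun i _ => Measurable.const_mul ?_ _
      exact ((hm t).comp ((measurable_pi_apply i).comp measurable_snd)).sub
        ((hm t).comp ((measurable_pi_apply i).comp measurable_fst))
    · refine ciSup_le fun t => ?_
      refine le_trans (le_of_eq ?_) (add_le_add (le_ciSup (hRb ε p.2) t)
        (le_ciSup (hRb (fun i => !ε i) p.1) t))
      rw [← Finset.sum_add_distrib]
      refine Finset.sum_congr rfl fun i _ => ?_
      cases ε i <;> simp <;> ring
  have hsum := Finset.sum_le_sum fun ε (_ : ε ∈ (Finset.univ : Finset (Fin n → Bool))) => hε ε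
  rw [Finset.sum_add_distrib, hflip, ← two_mul] at hsum
  rw [integral_finsetSum _ fun ε _ => hRi ε]
  simpa using hsum

end Symmetrization

namespace IsDisutility

variable {φ : ℝ → ℝ}

lemma sub_self_mul_le (hφ : IsDisutility φ) {θ : ℝ} (h0 : 0 ≤ θ) (h1 : θ ≤ 1) (y : ℝ) :
    φ (θ * y) - θ * y ≤ φ y - y := by
  obtain ⟨-, hconv, hzero, hle⟩ := hφ
  have h := hconv.2 (Set.mem_univ y) (Set.mem_univ 0) h0 (sub_nonneg.2 h1) (by ring)
  simp only [smul_eq_mul, mul_zero, add_zero, hzero] at h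
  nlinarith [mul_nonneg (sub_nonneg.2 h1) (sub_nonneg.2 (hle y))]

lemma sub_self_le_of_nonneg (hφ : IsDisutility φ) {w y : ℝ} (h0 : 0 ≤ w) (h1 : w ≤ y) :
    φ w - w ≤ φ y - y := by
  rcases h0.eq_or_lt with rfl | h0
  · simpa [hφ.2.2.1] using hφ.2.2.2 y
  · have hy := h0.trans_le h1
    have := hφ.sub_self_mul_le (div_nonneg h0.le hy.le) ((div_le_one hy).2 h1) y
    rwa [div_mul_cancel₀ _ hy.ne'] at this

lemma sub_self_le_of_nonpos (hφ : IsDisutility φ) {w y : ℝ} (h0 : w ≤ 0) (h1 : y ≤ w) :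
    φ w - w ≤ φ y - y := by
  rcases h0.eq_or_lt with rfl | h0
  · simpa [hφ.2.2.1] using hφ.2.2.2 y
  · have hy := h1.trans_lt h0
    have := hφ.sub_self_mul_le (div_nonneg_of_nonpos h0.le hy.le)
      ((div_le_one_of_neg hy).2 h1) y
    rwa [div_mul_cancel₀ _ hy.ne] at this

lemma sub_le_clamp_sub (hφ : IsDisutility φ) {M x : ℝ} (hx : x ∈ Set.Icc 0 M) (lam : ℝ) :
    lam - φ (lam - x) ≤ max 0 (min M lam) - φ (max 0 (min M lam) - x) := by
  obtain ⟨hx0, hxM⟩ := hx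
  have hM : 0 ≤ M := hx0.trans hxM
  rcases le_total lam 0 with h | h
  · rw [min_eq_right (h.trans hM), max_eq_left h]
    linarith [hφ.sub_self_le_of_nonpos (w := 0 - x) (y := lam - x) (by linarith) (by linarith)]
  · rcases le_total lam M with h' | h'
    · rw [min_eq_right h', max_eq_right h]
    · rw [min_eq_left h', max_eq_right hM]
      linarith [hφ.sub_self_le_of_nonneg (w := M - x) (y := lam - x) (by linarith) (by linarith)]

end IsDisutility

section InvertedRisk

variable {Z : Type*} [MeasurableSpace Z] {φ : ℝ → ℝ} {L M : ℝ} {f : Z → ℝ}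

lemma integrable_disutility_comp (Q : Measure Z) [IsProbabilityMeasure Q] (hφ : IsDisutility φ)
    (hL : ∀ x y : ℝ, |φ x - φ y| ≤ L * |x - y|) (hf : Measurable f)
    (hfM : ∀ z, f z ∈ Set.Icc 0 M) (lam : ℝ) : Integrable (fun z => φ (lam - f z)) Q := by
  obtain ⟨B, hB⟩ := exists_abs_le_comp_of_lipschitz hL (u := fun z => lam - f z)
    ⟨|lam| + M, fun z => (abs_sub _ _).trans
      (add_le_add le_rfl ((abs_of_nonneg (hfM z).1).trans_le (hfM z).2))⟩
  exact integrable_of_measurable_of_abs_le (hφ.1.measurable.comp (measurable_const.sub hf)) hB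

lemma sub_integral_le_clamp (Q : Measure Z) [IsProbabilityMeasure Q] (hφ : IsDisutility φ)
    (hL : ∀ x y : ℝ, |φ x - φ y| ≤ L * |x - y|) (hf : Measurable f)
    (hfM : ∀ z, f z ∈ Set.Icc 0 M) (lam : ℝ) :
    lam - ∫ z, φ (lam - f z) ∂Q ≤
      max 0 (min M lam) - ∫ z, φ (max 0 (min M lam) - f z) ∂Q := by
  have hi := integrable_disutility_comp Q hφ hL hf hfM
  have := integral_mono ((integrable_const lam).sub (hi lam))
    ((integrable_const (max 0 (min M lam))).sub (hi (max 0 (min M lam))))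
    fun z => hφ.sub_le_clamp_sub (hfM z) lam
  simp only [Pi.sub_apply] at this
  rw [integral_sub (integrable_const _) (hi _), integral_sub (integrable_const _) (hi _)] at this
  simpa using this

lemma bddAbove_range_IOCE (Q : Measure Z) [IsProbabilityMeasure Q] (hφ : IsDisutility φ)
    (hL : ∀ x y : ℝ, |φ x - φ y| ≤ L * |x - y|) (hf : Measurable f)
    (hfM : ∀ z, f z ∈ Set.Icc 0 M) :
    BddAbove (Set.range fun lam : ℝ => lam - ∫ z, φ (lam - f z) ∂Q) := by
  refine ⟨M, ?_⟩
  rintro _ ⟨lam, rfl⟩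
  have := integral_mono (integrable_const (lam - M))
    (integrable_disutility_comp Q hφ hL hf hfM lam)
    fun z => (by linarith [(hfM z).2, hφ.2.2.2 (lam - f z)] : lam - M ≤ φ (lam - f z))
  simp only [integral_const, probReal_univ, one_smul] at this
  linarith

lemma continuous_integral_disutility (Q : Measure Z) [IsProbabilityMeasure Q]
    (hφ : IsDisutility φ) (hL : ∀ x y : ℝ, |φ x - φ y| ≤ L * |x - y|) (hf : Measurable f)
    (hfM : ∀ z, f z ∈ Set.Icc 0 M) : Continuous fun lam : ℝ => ∫ z, φ (lam - f z) ∂Q := by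
  have hi := integrable_disutility_comp Q hφ hL hf hfM
  refine (LipschitzWith.of_dist_le_mul (K := Real.toNNReal L) fun x y => ?_).continuous
  rw [Real.dist_eq, Real.dist_eq, ← integral_sub (hi x) (hi y)]
  refine abs_integral_le_of_abs_le fun z => (hL _ _).trans ?_
  rw [sub_sub_sub_cancel_right]
  exact mul_le_mul_of_nonneg_right (Real.le_coe_toNNReal L) (abs_nonneg _)

/-- The inverted OCE risks of a `[0, M]`-valued function under two laws differ by at most the
largest difference of the expected disutilities over rational levels truncated to `[0, M]`. -/
lemma abs_IOCE_sub_IOCE_le (P Q : Measure Z) [IsProbabilityMeasure P] [IsProbabilityMeasure Q]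
    (hφ : IsDisutility φ) (hL : ∀ x y : ℝ, |φ x - φ y| ≤ L * |x - y|) (hf : Measurable f)
    (hfM : ∀ z, f z ∈ Set.Icc 0 M) {D : ℝ}
    (hD : ∀ q : ℚ, |∫ z, φ (max 0 (min M (q : ℝ)) - f z) ∂P -
      ∫ z, φ (max 0 (min M (q : ℝ)) - f z) ∂Q| ≤ D) :
    |IOCE φ f P - IOCE φ f Q| ≤ D := by
  have hcl : Continuous fun lam : ℝ => max 0 (min M lam) := by fun_prop
  have hD' : ∀ lam : ℝ, |∫ z, φ (max 0 (min M lam) - f z) ∂P -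
      ∫ z, φ (max 0 (min M lam) - f z) ∂Q| ≤ D := fun lam => by
    refine (Rat.denseRange_cast (𝕜 := ℝ)).induction_on lam ?_ hD
    exact isClosed_le (((continuous_integral_disutility P hφ hL hf hfM).comp hcl).sub
      ((continuous_integral_disutility Q hφ hL hf hfM).comp hcl)).abs continuous_const
  have hone : ∀ (P Q : Measure Z) [IsProbabilityMeasure P] [IsProbabilityMeasure Q],
      (∀ lam : ℝ, ∫ z, φ (max 0 (min M lam) - f z) ∂Q -
        ∫ z, φ (max 0 (min M lam) - f z) ∂P ≤ D) → IOCE φ f P ≤ IOCE φ f Q + D := by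
    intro P Q _ _ h
    refine ciSup_le fun lam => (sub_integral_le_clamp P hφ hL hf hfM lam).trans ?_
    have := le_ciSup (bddAbove_range_IOCE Q hφ hL hf hfM) (max 0 (min M lam))
    simp only [IOCE]
    linarith [h lam]
  rw [abs_sub_le_iff]
  constructor
  · linarith [hone P Q fun lam => by linarith [(abs_le.1 (hD' lam)).1]]
  · linarith [hone Q P fun lam => by linarith [(abs_le.1 (hD' lam)).2]]

lemma isProbabilityMeasure_empMeas {n : ℕ} (hn : 1 ≤ n) (z : Fin n → Z) :
    IsProbabilityMeasure (empMeas z) :=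
  ⟨by
    simp only [empMeas, Measure.smul_apply, Measure.coe_finsetSum, Finset.sum_apply,
      measure_univ, Finset.sum_const, Finset.card_univ, Fintype.card_fin, smul_eq_mul,
      nsmul_eq_mul, mul_one]
    exact ENNReal.inv_mul_cancel (by positivity) (ENNReal.natCast_ne_top n)⟩

lemma integral_empMeas {n : ℕ} (z : Fin n → Z) {g : Z → ℝ} (hg : Measurable g) :
    ∫ x, g x ∂(empMeas z) = (n : ℝ)⁻¹ * ∑ i, g (z i) := by
  rw [empMeas, integral_smul_measure, integral_finsetSum_measure]
  · simp [integral_dirac' _ _ hg.stronglyMeasurable]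
  · exact fun i _ => integrable_dirac' hg.stronglyMeasurable (by simp)

end InvertedRisk

section Rademacher

variable {Z : Type*} {F : Set (Z → ℝ)} {M : ℝ}

lemma abs_inv_mul_sum_signs_le {n : ℕ} (ε : Fin n → Bool) {x : Fin n → ℝ} {B : ℝ}
    (hx : ∀ i, |x i| ≤ B) :
    |(n : ℝ)⁻¹ * ∑ i, (if ε i then (1 : ℝ) else -1) * x i| ≤ (n : ℝ)⁻¹ * (n * B) := by
  rw [abs_mul, abs_of_nonneg (by positivity : (0 : ℝ) ≤ (n : ℝ)⁻¹)]
  gcongr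
  exact abs_sum_signs_mul_le ε hx

lemma integrable_rad [MeasurableSpace Z] (P : Measure Z) [IsProbabilityMeasure P]
    (hFc : F.Countable) (hFne : F.Nonempty) (hFmeas : ∀ f ∈ F, Measurable f)
    (hFbd : ∀ f ∈ F, ∀ z, f z ∈ Set.Icc 0 M) {n : ℕ} :
    Integrable (fun z : Fin n → Z => rad F z) (Measure.pi fun _ : Fin n => P) := by
  have := hFc.to_subtype
  have := hFne.to_subtype
  refine (integrable_finsetSum _ fun ε _ => ?_).const_mul _
  refine integrable_of_measurable_of_abs_le (Measurable.iSup fun f => Measurable.const_mul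
    (Finset.measurable_sum _ fun i _ =>
      ((hFmeas f f.2).comp (measurable_pi_apply i)).const_mul _) _) fun z =>
    abs_iSup_le_of_abs_le fun f => abs_inv_mul_sum_signs_le (B := M) ε fun i => ?_
  exact (abs_of_nonneg (hFbd f f.2 _).1).trans_le (hFbd f f.2 _).2

lemma abs_sub_clamp_le {M x : ℝ} (hx : x ∈ Set.Icc 0 M) (lam : ℝ) :
    |x - max 0 (min M lam)| ≤ M := by
  have h0 : 0 ≤ max 0 (min M lam) := le_max_left _ _
  have h1 : max 0 (min M lam) ≤ M := max_le (hx.1.trans hx.2) (min_le_left _ _)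
  exact abs_le.2 ⟨by linarith [hx.1], by linarith [hx.2]⟩

/-- Rademacher sums of a Lipschitz image of the class `F` shifted by levels in `[0, M]` are
controlled by the Rademacher average of `F`. -/
lemma sum_iSup_comp_le_rad (hFne : F.Nonempty) (hFbd : ∀ f ∈ F, ∀ z, f z ∈ Set.Icc 0 M)
    {ψ : ℝ → ℝ} {K : ℝ} (hψ : ∀ x y, |ψ x - ψ y| ≤ K * |x - y|) {n : ℕ} (hn : 1 ≤ n)
    (z : Fin n → Z) :
    ∑ ε : Fin n → Bool, ⨆ t : F × ℚ, ∑ i, (if ε i then (1 : ℝ) else -1) *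
        ψ ((t.1 : Z → ℝ) (z i) - max 0 (min M (t.2 : ℝ))) ≤
      2 ^ n * (K * (n * rad F z + M * √n)) := by
  have := hFne.to_subtype
  have hK : 0 ≤ K := by simpa using (abs_nonneg _).trans (hψ 1 0)
  have hM : 0 ≤ M := by
    obtain ⟨f, hf⟩ := hFne
    exact (hFbd f hf (z ⟨0, hn⟩)).1.trans (hFbd f hf (z ⟨0, hn⟩)).2
  have hn' : (n : ℝ) ≠ 0 := by positivity
  have hcontr := sum_iSup_comp_le hψ n
    (fun i (t : F × ℚ) => (t.1 : Z → ℝ) (z i) - max 0 (min M (t.2 : ℝ))) (fun _ => 0)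
    ⟨0, by simp⟩ fun i => ⟨M, fun t => abs_sub_clamp_le (hFbd _ t.1.2 _) _⟩
  simp only [zero_add] at hcontr
  refine hcontr.trans ?_
  set S : (Fin n → Bool) → ℝ := fun ε => ⨆ f : F, (n : ℝ)⁻¹ * ∑ i : Fin n,
    (if ε i then (1 : ℝ) else -1) * (f : Z → ℝ) (z i)
  have hpt : ∀ ε : Fin n → Bool, (⨆ t : F × ℚ, ∑ i, (if ε i then (1 : ℝ) else -1) *
      (K * ((t.1 : Z → ℝ) (z i) - max 0 (min M (t.2 : ℝ))))) ≤
      K * n * S ε + K * M * |∑ i, (if ε i then (1 : ℝ) else -1)| := fun ε => by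
    refine ciSup_le fun t => ?_
    set c := max 0 (min M (t.2 : ℝ))
    have hc0 : 0 ≤ c := le_max_left _ _
    have hcM : c ≤ M := max_le hM (min_le_left _ _)
    have h1 : (n : ℝ)⁻¹ * ∑ i : Fin n, (if ε i then (1 : ℝ) else -1) * (t.1 : Z → ℝ) (z i) ≤ S ε :=
      le_ciSup (f := fun f : F => (n : ℝ)⁻¹ * ∑ i : Fin n,
        (if ε i then (1 : ℝ) else -1) * (f : Z → ℝ) (z i))
        (bddAbove_range_of_abs_le ⟨_, fun f => abs_inv_mul_sum_signs_le (B := M) ε fun i =>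
          (abs_of_nonneg (hFbd f f.2 _).1).trans_le (hFbd f f.2 _).2⟩) t.1
    have h2 : -(c * ∑ i, (if ε i then (1 : ℝ) else -1)) ≤
        M * |∑ i, (if ε i then (1 : ℝ) else -1)| := by
      refine (neg_le_abs _).trans ?_
      rw [abs_mul, abs_of_nonneg hc0]
      gcongr
    have h3 : ∑ i, (if ε i then (1 : ℝ) else -1) * (K * ((t.1 : Z → ℝ) (z i) - c)) =
        K * n * ((n : ℝ)⁻¹ * ∑ i : Fin n, (if ε i then (1 : ℝ) else -1) * (t.1 : Z → ℝ) (z i)) +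
          K * -(c * ∑ i, (if ε i then (1 : ℝ) else -1)) := by
      rw [show ∀ s : ℝ, K * n * ((n : ℝ)⁻¹ * s) = K * s from fun s => by field_simp,
        ← mul_add, Finset.mul_sum, ← sub_eq_add_neg, ← Finset.sum_sub_distrib, Finset.mul_sum]
      exact Finset.sum_congr rfl fun i _ => by ring
    rw [h3, mul_assoc K M]
    exact add_le_add (mul_le_mul_of_nonneg_left h1 (by positivity))
      (mul_le_mul_of_nonneg_left h2 hK)
  refine (Finset.sum_le_sum fun ε _ => hpt ε).trans ?_
  rw [Finset.sum_add_distrib, ← Finset.mul_sum, ← Finset.mul_sum]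
  have hrad : ∑ ε, S ε = 2 ^ n * rad F z := by
    rw [rad, mul_inv_cancel_left₀ (by positivity)]
  rw [hrad]
  have := mul_le_mul_of_nonneg_left (sum_abs_signs_le n) (mul_nonneg hK hM)
  linarith

end Rademacher

/-- A high-probability bound for the one-sided deviation of a Lipschitz image of the class `F`
shifted by levels in `[0, M]`. -/
lemma measureReal_supDeviation_ge_le {Z : Type*} [MeasurableSpace Z] (P : Measure Z)
    [IsProbabilityMeasure P] {F : Set (Z → ℝ)} {M : ℝ} (hM : 0 < M) (hFc : F.Countable)
    (hFne : F.Nonempty) (hFmeas : ∀ f ∈ F, Measurable f)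
    (hFbd : ∀ f ∈ F, ∀ z, f z ∈ Set.Icc 0 M) {ψ : ℝ → ℝ} (hψm : Measurable ψ) (hψ0 : ψ 0 = 0)
    {L : ℝ} (hL : 0 < L) {n : ℕ} (hn : 1 ≤ n) (hψ : ∀ x y, |ψ x - ψ y| ≤ L / n * |x - y|)
    {δ : ℝ} (hδ : δ ∈ Set.Ioc (0 : ℝ) 1) :
    (Measure.pi fun _ : Fin n => P).real
        {z | L * (2 * (∫ w, rad F w ∂(Measure.pi fun _ : Fin n => P)) +
          M * (2 + √(Real.log (2 / δ))) / √n) ≤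
            supDeviation P (fun (t : F × ℚ) x =>
              ψ ((t.1 : Z → ℝ) x - max 0 (min M (t.2 : ℝ)))) z} ≤ δ / 2 := by
  have := hFc.to_subtype
  have := hFne.to_subtype
  have hn0 : (0 : ℝ) < n := by positivity
  set μ := Measure.pi fun _ : Fin n => P
  set h : F × ℚ → Z → ℝ := fun t x => ψ ((t.1 : Z → ℝ) x - max 0 (min M (t.2 : ℝ)))
  have hm : ∀ t, Measurable (h t) := fun t =>
    hψm.comp ((hFmeas _ t.1.2).sub measurable_const)
  have hB : ∀ t x, |h t x| ≤ L / n * M := fun t x => by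
    have h1 := hψ ((t.1 : Z → ℝ) x - max 0 (min M (t.2 : ℝ))) 0
    rw [hψ0, sub_zero, sub_zero] at h1
    exact h1.trans (mul_le_mul_of_nonneg_left (abs_sub_clamp_le (hFbd _ t.1.2 _) _)
      (by positivity))
  have hosc : ∀ t x y, |h t x - h t y| ≤ L / n * M := fun t x y => by
    refine (hψ _ _).trans (mul_le_mul_of_nonneg_left ?_ (by positivity))
    have hx := hFbd _ t.1.2 x
    have hy := hFbd _ t.1.2 y
    exact abs_le.2 ⟨by linarith [hx.1, hy.2], by linarith [hx.2, hy.1]⟩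
  have hmean : ∫ z, supDeviation P h z ∂μ ≤ L * (2 * ∫ w, rad F w ∂μ + 2 * M / √n) := by
    have h1 := integral_supDeviation_le P hm hB (n := n)
    have hri := integrable_rad P hFc hFne hFmeas hFbd (n := n)
    have h2 : ∫ z, ∑ ε : Fin n → Bool, ⨆ t, ∑ i, (if ε i then (1 : ℝ) else -1) * h t (z i) ∂μ ≤
        ∫ z, 2 ^ n * (L / n * (n * rad F z + M * √n)) ∂μ :=
      integral_mono (integrable_finsetSum _ fun ε _ => integrable_iSup_signs P hm hB ε)
        ((((hri.const_mul _).add (integrable_const _)).const_mul _).const_mul _)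
        fun z => sum_iSup_comp_le_rad hFne hFbd hψ hn z
    rw [integral_const_mul, integral_const_mul, integral_add (hri.const_mul _)
      (integrable_const _), integral_const_mul, integral_const, probReal_univ, one_smul] at h2
    have h3 : 2 ^ n * ∫ z, supDeviation P h z ∂μ ≤
        2 ^ n * (2 * (L / n * (n * ∫ w, rad F w ∂μ + M * √n))) := by linarith
    refine (le_of_mul_le_mul_left h3 (by positivity)).trans (le_of_eq ?_)
    have : L / n * (n * ∫ w, rad F w ∂μ + M * √n) = L * (∫ w, rad F w ∂μ + M / √n) := by
      have e : √(n : ℝ) / n = 1 / √n := Real.sqrt_div_self'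
      calc L / n * (n * ∫ w, rad F w ∂μ + M * √n)
          = L * (n / n * ∫ w, rad F w ∂μ + M * (√n / n)) := by ring
        _ = _ := by rw [e, div_self hn0.ne']; ring
    rw [this]
    ring
  have hlog : 0 ≤ Real.log (2 / δ) :=
    Real.log_nonneg ((one_le_div hδ.1).2 (by linarith [hδ.2]))
  have hmcd := measureReal_ge_le_of_bounded_differences P (n := n) (measurable_supDeviation P hm)
    (abs_supDeviation_le P hB) (supDeviation_bounded_differences P hB hosc)
    (r := L * (M * √(Real.log (2 / δ)) / √n)) (by positivity)
  refine (measureReal_mono fun z hz => ?_).trans (hmcd.trans ?_)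
  · simp only [Set.mem_ofPred_eq] at hz ⊢
    have e : L * (2 * (∫ w, rad F w ∂μ) + M * (2 + √(Real.log (2 / δ))) / √n) =
        L * (2 * ∫ w, rad F w ∂μ + 2 * M / √n) + L * (M * √(Real.log (2 / δ)) / √n) := by ring
    linarith
  · have e : -(2 * (L * (M * √(Real.log (2 / δ)) / √n)) ^ 2) / (n * (L / n * M) ^ 2) =
        -(2 * Real.log (2 / δ)) := by
      rw [mul_pow, div_pow, mul_pow, Real.sq_sqrt hlog, Real.sq_sqrt hn0.le]
      field_simp
    rw [e]
    calc Real.exp (-(2 * Real.log (2 / δ))) ≤ Real.exp (-Real.log (2 / δ)) :=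
          Real.exp_le_exp.2 (by linarith)
      _ = δ / 2 := by
          rw [Real.exp_neg, Real.exp_log (div_pos two_pos hδ.1), inv_div]

/-- uniform convergence of the empirical inverted OCE risk to the population
inverted OCE risk, in terms of the expected Rademacher average of the hypothesis class. -/
theorem ioce_uniform_convergence {Z : Type*} [MeasurableSpace Z]
    (P : Measure Z) [IsProbabilityMeasure P] (M : ℝ) (hM : 0 < M)
    (F : Set (Z → ℝ)) (hFc : F.Countable) (hFne : F.Nonempty)
    (hFmeas : ∀ f ∈ F, Measurable f) (hFbd : ∀ f ∈ F, ∀ z, f z ∈ Set.Icc 0 M)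
    (φ : ℝ → ℝ) (hφ : IsDisutility φ)
    (L : ℝ) (hL : ∀ x y : ℝ, |φ x - φ y| ≤ L * |x - y|)
    (n : ℕ) (hn : 1 ≤ n) (δ : ℝ) (hδ : δ ∈ Set.Ioc (0 : ℝ) 1) :
    ENNReal.ofReal (1 - δ) ≤
      (Measure.pi fun _ : Fin n => P)
        {z : Fin n → Z |
          (⨆ f : F, |IOCE φ (f : Z → ℝ) P - IOCE φ (f : Z → ℝ) (empMeas z)|) ≤
            L * (2 * (∫ w, rad F w ∂(Measure.pi fun _ : Fin n => P)) +
              M * (2 + Real.sqrt (Real.log (2 / δ))) / Real.sqrt n)} := by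
  have hL1 : 1 ≤ L := by
    have h1 := hL 1 0
    rw [hφ.2.2.1, sub_zero, sub_zero, abs_one, mul_one] at h1
    exact (hφ.2.2.2 1).trans ((le_abs_self _).trans h1)
  have hn0 : (0 : ℝ) < n := by positivity
  have := hFne.to_subtype
  set μ := Measure.pi fun _ : Fin n => P
  set R := L * (2 * (∫ w, rad F w ∂μ) + M * (2 + Real.sqrt (Real.log (2 / δ))) / Real.sqrt n)
  set D : ℝ → (Fin n → Z) → ℝ := fun σ z => supDeviation P (fun (t : F × ℚ) x =>
    (fun y => σ * ((n : ℝ)⁻¹ * φ (-y))) ((t.1 : Z → ℝ) x - max 0 (min M (t.2 : ℝ)))) z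
  have hφm : ∀ σ : ℝ, Measurable fun y => σ * ((n : ℝ)⁻¹ * φ (-y)) := fun σ =>
    ((hφ.1.measurable.comp measurable_neg).const_mul _).const_mul _
  have hlip : ∀ σ : ℝ, |σ| = 1 → ∀ x y : ℝ,
      |σ * ((n : ℝ)⁻¹ * φ (-x)) - σ * ((n : ℝ)⁻¹ * φ (-y))| ≤ L / n * |x - y| := by
    intro σ hσ x y
    rw [← mul_sub, ← mul_sub, abs_mul, abs_mul, hσ, one_mul, abs_of_pos (inv_pos.2 hn0)]
    have h1 := mul_le_mul_of_nonneg_left (hL (-x) (-y)) (inv_pos.2 hn0).le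
    rw [show -x - -y = -(x - y) by ring, abs_neg] at h1
    exact h1.trans (le_of_eq (by ring))
  have htail : ∀ σ : ℝ, |σ| = 1 → μ.real {z | R ≤ D σ z} ≤ δ / 2 := fun σ hσ =>
    measureReal_supDeviation_ge_le P hM hFc hFne hFmeas hFbd (hφm σ) (by simp [hφ.2.2.1])
      (by linarith) hn (hlip σ hσ) hδ
  have hle : ∀ σ : ℝ, |σ| = 1 → ∀ z (f : F) (q : ℚ),
      σ * (∫ x, φ (max 0 (min M (q : ℝ)) - (f : Z → ℝ) x) ∂P -
        ∫ x, φ (max 0 (min M (q : ℝ)) - (f : Z → ℝ) x) ∂(empMeas z)) ≤ D σ z := by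
    intro σ hσ z f q
    have hb : ∀ (t : F × ℚ) x, |σ * ((n : ℝ)⁻¹ *
        φ (-((t.1 : Z → ℝ) x - max 0 (min M (t.2 : ℝ)))))| ≤ L / n * M := fun t x => by
      have h1 := hlip σ hσ ((t.1 : Z → ℝ) x - max 0 (min M (t.2 : ℝ))) 0
      rw [neg_zero, hφ.2.2.1, mul_zero, mul_zero, sub_zero, sub_zero] at h1
      exact h1.trans (mul_le_mul_of_nonneg_left (abs_sub_clamp_le (hFbd _ t.1.2 _) _)
        (by positivity))
    refine le_of_eq_of_le ?_ (le_ciSup (bddAbove_range_of_abs_le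
      ⟨_, abs_sum_integral_sub_le P hb z⟩) (f, q))
    rw [integral_empMeas z (g := fun x => φ (max 0 (min M (q : ℝ)) - (f : Z → ℝ) x))
      (hφ.1.measurable.comp (measurable_const.sub (hFmeas f f.2)))]
    simp only [neg_sub, Finset.sum_sub_distrib, integral_const_mul, Finset.sum_const,
      Finset.card_univ, Fintype.card_fin, nsmul_eq_mul, ← Finset.mul_sum]
    field_simp
  have hsub : ({z | R ≤ D 1 z} ∪ {z | R ≤ D (-1) z})ᶜ ⊆
      {z : Fin n → Z | (⨆ f : F, |IOCE φ (f : Z → ℝ) P - IOCE φ (f : Z → ℝ) (empMeas z)|) ≤ R} := by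
    intro z hz
    simp only [Set.mem_compl_iff, Set.mem_union, Set.mem_ofPred_eq, not_or, not_le] at hz
    have := isProbabilityMeasure_empMeas hn z
    change (⨆ f : F, |IOCE φ (f : Z → ℝ) P - IOCE φ (f : Z → ℝ) (empMeas z)|) ≤ R
    refine ciSup_le fun f => ?_
    refine abs_IOCE_sub_IOCE_le P (empMeas z) hφ hL (hFmeas f f.2) (hFbd f f.2) fun q =>
      abs_le.2 ⟨?_, ?_⟩
    · linarith [hle (-1) (by simp) z f q]
    · linarith [hle 1 (by simp) z f q]
  have hDm : ∀ σ, Measurable (D σ) := fun σ => by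
    have := hFc.to_subtype
    exact measurable_supDeviation P fun t => (hφm σ).comp ((hFmeas _ t.1.2).sub measurable_const)
  have hmeas : MeasurableSet ({z | R ≤ D 1 z} ∪ {z | R ≤ D (-1) z}) :=
    (measurableSet_le measurable_const (hDm 1)).union
      (measurableSet_le measurable_const (hDm (-1)))
  refine le_trans ?_ (measure_mono hsub)
  rw [← ofReal_measureReal, probReal_compl_eq_one_sub hmeas]
  refine ENNReal.ofReal_le_ofReal ?_
  linarith [measureReal_union_le (μ := μ) {z | R ≤ D 1 z} {z | R ≤ D (-1) z},
    htail 1 (by simp), htail (-1) (by simp)]
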